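/- arXiv:2001.08516 — 4 statements merged into one kernel-verified Lean document; each statement's English description precedes it below -/
import Mathlib

section
/- Let S be a sorted array of length m over a linear order, let v ≥ 1 with (v+1) dividing m, and set ω = m/(v+1). Mark as sample positions the indices ωj−1 for j = 1,…,v. Then for every contiguous index interval I of S: if I contains exactly k of the sample positions, then the number of entries of S indexed by I is at most (k+1)·ω. -/
/-- Lemma `string-subarray`: Let `S` be a sorted array of length `m`
over a linear order, `v ≥ 1` with `(v+1) ∣ m`, `ω = m/(v+1)`, and sample positions
`ω*j - 1` for `j = 1,…,v`.  Every contiguous index interval of `S` containing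
exactly `k` sample positions indexes at most `(k+1)·ω` entries. -/
theorem regular_sampling_subarray_bound
    {α : Type*} [LinearOrder α] (m v : ℕ) (S : ℕ → α)
    (hsorted : ∀ s t : ℕ, s ≤ t → t < m → S s ≤ S t)
    (hv : 1 ≤ v) (hdvd : (v + 1) ∣ m)
    (ω : ℕ) (hω : ω = m / (v + 1))
    (samples : Finset ℕ)
    (hsamples : samples = (Finset.Icc 1 v).image (fun j => ω * j - 1))
    (a b k : ℕ)
    (hsub : Finset.Icc a b ⊆ Finset.range m)
    (hk : (Finset.Icc a b ∩ samples).card = k) :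
    (Finset.Icc a b).card ≤ (k + 1) * ω := by
  subst hsamples
  have hm : m = (v + 1) * ω := by rw [hω, Nat.mul_div_cancel' hdvd]
  rcases lt_or_ge b a with hba | hab
  · simp [Finset.Icc_eq_empty_of_lt hba]
  have hbm : b < m := Finset.mem_range.mp (hsub (Finset.mem_Icc.mpr ⟨hab, le_rfl⟩))
  have hpos : 0 < ω := by
    rcases Nat.eq_zero_or_pos ω with h | h
    · simp [hm, h] at hbm
    · exact h
  set p := a / ω
  set r := min v ((b + 1) / ω) with hr
  have hpa : p * ω ≤ a := Nat.div_mul_le_self a ω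
  have hap : a < (p + 1) * ω := by
    rw [mul_comm]
    exact Nat.lt_mul_div_succ a hpos
  have hrb : r * ω ≤ b + 1 :=
    (Nat.mul_le_mul_right ω (min_le_right _ _)).trans (Nat.div_mul_le_self (b + 1) ω)
  have hbr : b + 1 ≤ (r + 1) * ω := by
    rcases min_choice v ((b + 1) / ω) with h | h
    · rw [hr, h, ← hm]
      exact hbm
    · rw [hr, h, mul_comm]
      exact (Nat.lt_mul_div_succ (b + 1) hpos).le
  have hcard : r - p ≤ k := by
    have hinj : Set.InjOn (fun j => ω * j - 1) (Finset.Icc (p + 1) r : Set ℕ) := by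
      intro x hx y hy hxy
      simp only [Finset.coe_Icc, Set.mem_Icc] at hx hy
      have hx' : 0 < ω * x := Nat.mul_pos hpos ((Nat.succ_pos p).trans_le hx.1)
      have hy' : 0 < ω * y := Nat.mul_pos hpos ((Nat.succ_pos p).trans_le hy.1)
      have hxy' : ω * x - 1 = ω * y - 1 := hxy
      exact Nat.eq_of_mul_eq_mul_left hpos (by omega)
    have himage : (Finset.Icc (p + 1) r).image (fun j => ω * j - 1) ⊆
        Finset.Icc a b ∩ (Finset.Icc 1 v).image (fun j => ω * j - 1) := by
      intro x hx
      obtain ⟨j, hj, rfl⟩ := Finset.mem_image.mp hx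
      rw [Finset.mem_Icc] at hj
      have hjv : j ≤ v := hj.2.trans (min_le_left _ _)
      have hlow : (p + 1) * ω ≤ j * ω := Nat.mul_le_mul_right ω hj.1
      have hhigh : j * ω ≤ r * ω := Nat.mul_le_mul_right ω hj.2
      rw [Finset.mem_inter, Finset.mem_Icc]
      refine ⟨?_, Finset.mem_image_of_mem _ (Finset.mem_Icc.mpr ⟨(Nat.succ_pos p).trans_le hj.1, hjv⟩)⟩
      rw [mul_comm ω j]
      omega
    have hle := Finset.card_le_card himage
    rw [Finset.card_image_of_injOn hinj, hk, Nat.card_Icc] at hle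
    omega
  rw [Nat.card_Icc]
  have hmul : (r + 1) * ω ≤ (k + 1 + p) * ω := Nat.mul_le_mul_right ω (by omega)
  rw [add_mul (k + 1) p ω] at hmul
  omega
end

section
/- Let p ≥ 1 and v ≥ 1, and for i = 1,…,p let S_i be a sorted array of length n/p over a linear order, where the n entries of all arrays together are pairwise distinct and (v+1) divides n/p; set ω = (n/p)/(v+1). On each array S_i mark the regular samples S_i[ωj−1] for j = 1,…,v, let V be the sorted array of all p·v samples, and define splitters f_j = V[vj−1] for j = 1,…,p−1, with sentinels f_0 = −∞ and f_p = +∞. For j = 1,…,p let bucket b_j be the set of all entries s of all arrays S_1,…,S_p with f_{j−1} < s ≤ f_j. Then every bucket b_j contains at most n/p + n/v elements. -/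
/-- In a sorted array of length `ω * (v + 1)`, the entries satisfying an order-convex predicate `P`
number at most `ω` times one more than the number of regular samples satisfying `P`. -/
theorem card_filter_le_of_regular_samples {α : Type*} [LinearOrder α] (S : ℕ → α) (v ω : ℕ)
    (hω : 0 < ω)
    (hsorted : ∀ s t : ℕ, s ≤ t → t < ω * (v + 1) → S s ≤ S t)
    (P : α → Prop) [DecidablePred P]
    (hP : ∀ x y z, x ≤ y → y ≤ z → P x → P z → P y) :
    ((Finset.range (ω * (v + 1))).filter (fun t => P (S t))).card
      ≤ ω + ω * ((Finset.Icc 1 v).filter (fun k => P (S (ω * k - 1)))).card := by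
  set T := (Finset.range (ω * (v + 1))).filter (fun t => P (S t)) with hT
  set K := (Finset.Icc 1 v).filter (fun k => P (S (ω * k - 1))) with hK
  rcases T.eq_empty_or_nonempty with h | h
  · simp [h]
  set m := T.min' h
  have hmT : m ∈ T := T.min'_mem h
  have hsub : T ⊆ Finset.Ico m (m + ω) ∪ K.biUnion (fun k => Finset.Ico (ω * k) (ω * k + ω)) := by
    intro t ht
    have hmt : m ≤ t := T.min'_le t ht
    rw [Finset.mem_union]
    by_cases hlt : t < m + ω
    · exact Or.inl (Finset.mem_Ico.2 ⟨hmt, hlt⟩)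
    right
    simp only [hT, Finset.mem_filter, Finset.mem_range] at ht hmT
    have h1 := Nat.div_add_mod t ω
    have h2 := Nat.mod_lt t hω
    have h3 : 1 ≤ t / ω := (Nat.one_le_div_iff hω).2 (by omega)
    have h4 : t / ω < v + 1 := Nat.div_lt_of_lt_mul ht.1
    have h5 : 1 ≤ ω * (t / ω) := Nat.mul_pos hω h3
    rw [Finset.mem_biUnion]
    refine ⟨t / ω, ?_, Finset.mem_Ico.2 ⟨by omega, by omega⟩⟩
    rw [hK, Finset.mem_filter, Finset.mem_Icc]
    exact ⟨⟨h3, by omega⟩, hP _ _ _ (hsorted m _ (by omega) (by omega))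
      (hsorted _ t (by omega) ht.1) hmT.2 ht.2⟩
  calc T.card ≤ _ := Finset.card_le_card hsub
    _ ≤ (Finset.Ico m (m + ω)).card
        + (K.biUnion (fun k => Finset.Ico (ω * k) (ω * k + ω))).card := Finset.card_union_le _ _
    _ ≤ ω + K.card * ω := by
        gcongr
        · simp
        · exact Finset.card_biUnion_le_card_mul _ _ _ (by simp)
    _ = ω + ω * K.card := by rw [mul_comm]


/-- Theorem `string-splitting`: `p` sorted arrays `S i` of length
`n/p = c` each, all `n` entries pairwise distinct, `(v+1) ∣ c`, `ω = c/(v+1)`,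
regular samples `S i (ω*j - 1)` for `j = 1,…,v`; `V` is the sorted array of all
`p·v` samples and the splitters are `f j = V (v*j - 1)` for `j = 1,…,p-1`, with
sentinels `f 0 = -∞` and `f p = +∞`.  Then every bucket
`b j = { s : f (j-1) < s ≤ f j }` contains at most `n/p + n/v` elements. -/
theorem string_splitting_bucket_bound
    {α : Type*} [LinearOrder α] (p v n c : ℕ)
    (hp : 1 ≤ p) (hv : 1 ≤ v) (hn : n = p * c)
    (S : ℕ → ℕ → α)
    (hsorted : ∀ i < p, ∀ s t : ℕ, s ≤ t → t < c → S i s ≤ S i t)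
    (hdistinct : ∀ i₁ < p, ∀ t₁ < c, ∀ i₂ < p, ∀ t₂ < c,
        S i₁ t₁ = S i₂ t₂ → i₁ = i₂ ∧ t₁ = t₂)
    (hdvd : (v + 1) ∣ c) (ω : ℕ) (hω : ω = c / (v + 1))
    (V : ℕ → α)
    (hVsorted : ∀ s t : ℕ, s ≤ t → t < p * v → V s ≤ V t)
    (hVinj : ∀ s < p * v, ∀ t < p * v, V s = V t → s = t)
    (hVimage : (Finset.range (p * v)).image V
        = ((Finset.range p) ×ˢ (Finset.Icc 1 v)).image
            (fun x => S x.1 (ω * x.2 - 1)))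
    (f : ℕ → α)
    (hf : ∀ j, 1 ≤ j → j ≤ p - 1 → f j = V (v * j - 1))
    (j : ℕ) (hj1 : 1 ≤ j) (hjp : j ≤ p) :
    (((Finset.range p) ×ˢ (Finset.range c)).filter
        (fun x => (j = 1 ∨ f (j - 1) < S x.1 x.2) ∧ (j = p ∨ S x.1 x.2 ≤ f j))).card
      ≤ n / p + n / v := by
  obtain ⟨w, rfl⟩ := hdvd
  rw [Nat.mul_div_cancel_left w (Nat.succ_pos v)] at hω
  subst hω
  rw [mul_comm (v + 1) ω] at *
  subst hn
  rcases Nat.eq_zero_or_pos ω with rfl | hω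
  · simp
  classical
  let P : α → Prop := fun x => (j = 1 ∨ f (j - 1) < x) ∧ (j = p ∨ x ≤ f j)
  have hP : ∀ x y z, x ≤ y → y ≤ z → P x → P z → P y := fun x y z hxy hyz hx hz =>
    ⟨hx.1.imp_right fun h => h.trans_le hxy, hz.2.imp_right fun h => hyz.trans h⟩
  have hpos : ∀ k ∈ Finset.Icc 1 v, 1 ≤ ω * k ∧ ω * k - 1 < ω * (v + 1) := by
    intro k hk
    rw [Finset.mem_Icc] at hk
    have h1 : 1 ≤ ω * k := Nat.mul_pos hω hk.1
    have h2 : ω * k ≤ ω * (v + 1) := Nat.mul_le_mul_left _ (by omega)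
    omega
  have hsamples : (((Finset.range p) ×ˢ (Finset.Icc 1 v)).filter
      (fun x => P (S x.1 (ω * x.2 - 1)))).card ≤ v := by
    rw [← Finset.card_image_of_injOn (f := fun x : ℕ × ℕ => S x.1 (ω * x.2 - 1))]
    · have hsub : (((Finset.range p) ×ˢ (Finset.Icc 1 v)).filter
          (fun x => P (S x.1 (ω * x.2 - 1)))).image (fun x : ℕ × ℕ => S x.1 (ω * x.2 - 1))
          ⊆ (Finset.Ico (v * (j - 1)) (v * (j - 1) + v)).image V := by
        intro y hy
        obtain ⟨x, hx, rfl⟩ := Finset.mem_image.1 hy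
        rw [Finset.mem_filter] at hx
        have hmem := Finset.mem_image_of_mem (fun x : ℕ × ℕ => S x.1 (ω * x.2 - 1)) hx.1
        rw [← hVimage] at hmem
        obtain ⟨s, hs, hsx⟩ := Finset.mem_image.1 hmem
        rw [Finset.mem_range] at hs
        have hPs := hx.2
        rw [← hsx] at hPs
        refine Finset.mem_image.2 ⟨s, Finset.mem_Ico.2 ?_, hsx⟩
        obtain ⟨i, rfl⟩ : ∃ i, j = i + 1 := ⟨j - 1, by omega⟩
        simp only [Nat.add_sub_cancel]
        constructor
        · rcases hPs.1 with h | h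
          · obtain rfl : i = 0 := by omega
            simp
          · by_contra! hlt
            have hi : 1 ≤ i := by
              by_contra! h0
              obtain rfl : i = 0 := by omega
              simp at hlt
            have hle : v * i ≤ p * v := by
              rw [mul_comm]; exact Nat.mul_le_mul_right _ (by omega)
            rw [Nat.add_sub_cancel, hf i hi (by omega)] at h
            exact absurd (hVsorted s (v * i - 1) (by omega) (by omega)) (not_le.2 h)
        · rcases hPs.2 with h | h
          · rw [← h] at hs
            calc s < (i + 1) * v := hs
              _ = v * i + v := by ring
          · by_cases hip : i + 1 = p
            · rw [← hip] at hs
              calc s < (i + 1) * v := hs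
                _ = v * i + v := by ring
            · by_contra! hge
              rw [hf (i + 1) (by omega) (by omega), mul_add, mul_one] at h
              have h' := hVsorted (v * i + v - 1) s (by omega) hs
              have := hVinj _ hs _ (by omega) (le_antisymm h h')
              omega
      calc _ ≤ _ := Finset.card_le_card hsub
        _ ≤ (Finset.Ico (v * (j - 1)) (v * (j - 1) + v)).card := Finset.card_image_le
        _ = v := by simp
    · rintro ⟨i₁, k₁⟩ h₁ ⟨i₂, k₂⟩ h₂ heq
      simp only [Finset.coe_filter, Finset.mem_product, Set.mem_ofPred_eq, Finset.mem_range]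
        at h₁ h₂
      have hk₁ := hpos k₁ h₁.1.2
      have hk₂ := hpos k₂ h₂.1.2
      obtain ⟨hi, hk⟩ := hdistinct i₁ h₁.1.1 _ hk₁.2 i₂ h₂.1.1 _ hk₂.2 heq
      have hk' : ω * k₁ = ω * k₂ := by omega
      rw [hi, Nat.eq_of_mul_eq_mul_left hω hk']
  have hcard : ∀ B : Finset ℕ, ∀ g : ℕ → ℕ → α,
      (((Finset.range p) ×ˢ B).filter (fun x => P (g x.1 x.2))).card
        = ∑ i ∈ Finset.range p, (B.filter (fun t => P (g i t))).card := by
    intro B g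
    simp only [Finset.card_filter, Finset.sum_product]
  have hdiv₁ : p * (ω * (v + 1)) / p = ω * (v + 1) := Nat.mul_div_cancel_left _ hp
  have hdiv₂ : p * ω ≤ p * (ω * (v + 1)) / v := by
    rw [Nat.le_div_iff_mul_le hv, mul_assoc]
    gcongr
    omega
  have hbucket := hcard (Finset.range (ω * (v + 1))) S
  have hsum := hcard (Finset.Icc 1 v) (fun i k => S i (ω * k - 1))
  calc _ = ∑ i ∈ Finset.range p,
        ((Finset.range (ω * (v + 1))).filter (fun t => P (S i t))).card := by
        rw [← hbucket]
    _ ≤ ∑ i ∈ Finset.range p,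
        (ω + ω * ((Finset.Icc 1 v).filter (fun k => P (S i (ω * k - 1)))).card) :=
        Finset.sum_le_sum fun i hi => card_filter_le_of_regular_samples (S i) v ω hω
          (hsorted i (Finset.mem_range.1 hi)) P hP
    _ = p * ω + ω * (((Finset.range p) ×ˢ (Finset.Icc 1 v)).filter
          (fun x => P (S x.1 (ω * x.2 - 1)))).card := by
        rw [hsum, Finset.sum_add_distrib, ← Finset.mul_sum]
        simp
    _ ≤ p * ω + ω * v := by gcongr
    _ ≤ _ := by
        have hexp : ω * (v + 1) = ω * v + ω := by ring
        rw [hdiv₁]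
        omega
end

section
/- Let S = [s_0,…,s_{m−1}] be a sorted array of strings with lengths ℓ_t, total character count L, and maximal length ℓ̂; let v ≥ 1 with (v+1) dividing L, set ω' = L/(v+1), assume ℓ̂ ≤ ω', and let q_1,…,q_v be the character-based sample indices q_j = min{ t : P_t ≥ jω'−1 } where P_t = Σ_{u<t} ℓ_u. Then for every contiguous index interval I of S: if I contains exactly k of the sample indices q_1,…,q_v, then the total character length Σ_{t∈I} ℓ_t of the strings indexed by I is at most (k+1)·(ω' + ℓ̂). -/
/-- Lemma `char-subarray`: With the character-based sample indices
`q j = min { t : P t ≥ j·ω' - 1 }` (`j = 1,…,v`) of a sorted array of strings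
`S 0, …, S (m-1)` with lengths `ℓ`, total length `L`, `ω' = L/(v+1)` and
maximal string length `lhat ≤ ω'`: every contiguous index interval containing
exactly `k` of the sample indices has total character length at most
`(k+1)·(ω' + lhat)`. -/
theorem char_based_sampling_subarray_bound
    {α : Type*} [LinearOrder α] (m v : ℕ) (hm : 1 ≤ m)
    (S : ℕ → List α)
    (hsorted : ∀ s t : ℕ, s ≤ t → t < m → S s ≤ S t)
    (ℓ : ℕ → ℕ) (hℓ : ∀ t, ℓ t = (S t).length)
    (L : ℕ) (hL : L = ∑ t ∈ Finset.range m, ℓ t)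
    (lhat : ℕ) (hlhat : lhat = (Finset.range m).sup ℓ)
    (hv : 1 ≤ v) (hdvd : (v + 1) ∣ L)
    (ω' : ℕ) (hω' : ω' = L / (v + 1))
    (hshort : lhat ≤ ω')
    (P : ℕ → ℕ) (hP : ∀ t, P t = ∑ u ∈ Finset.range t, ℓ u)
    (q : ℕ → ℕ) (hq : ∀ j, q j = sInf {t | j * ω' - 1 ≤ P t})
    (a b k : ℕ)
    (hsub : Finset.Icc a b ⊆ Finset.range m)
    (hk : (Finset.Icc a b ∩ (Finset.Icc 1 v).image q).card = k) :
    ∑ t ∈ Finset.Icc a b, ℓ t ≤ (k + 1) * (ω' + lhat) := by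
  have hmem : ∀ {t}, t < m → ℓ t ≤ lhat := fun ht ↦
    hlhat ▸ Finset.le_sup (Finset.mem_range.2 ht)
  have hmono : Monotone P := fun s t hst ↦ by
    rw [hP, hP]
    exact Finset.sum_le_sum_of_subset (Finset.range_subset_range.2 hst)
  have hsucc : ∀ t, P (t + 1) = P t + ℓ t := fun t ↦ by rw [hP, hP, Finset.sum_range_succ]
  rcases lt_or_ge b a with hab | hab
  · simp [Finset.Icc_eq_empty_of_lt hab]
  have hbm : b < m := Finset.mem_range.1 (hsub (Finset.mem_Icc.2 ⟨hab, le_rfl⟩))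
  rcases Nat.eq_zero_or_pos lhat with h0 | hpos
  · rw [Finset.sum_eq_zero fun t ht ↦
      Nat.le_zero.1 (h0 ▸ hmem (Finset.mem_range.1 (hsub ht)))]
    exact Nat.zero_le _
  have hω : 0 < ω' := hpos.trans_le hshort
  have hLω : L = (v + 1) * ω' := by rw [hω', Nat.mul_div_cancel' hdvd]
  have hPL : P (b + 1) ≤ L := by
    rw [hL, ← hP]
    exact hmono hbm
  have hsum : P a + ∑ t ∈ Finset.Icc a b, ℓ t = P (b + 1) := by
    rw [hP, hP, ← Finset.sum_range_add_sum_Ico ℓ (Nat.le_succ_of_le hab)]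
    rfl
  by_contra! hlong
  have hklhat : lhat ≤ (k + 1) * lhat := Nat.le_mul_of_pos_left _ k.succ_pos
  have hblen := hmem hbm
  have hPb := hsucc b
  -- The ranks `j * ω' - 1` with `i < j ≤ i + k + 1` all lie strictly between `P a` and `P b`.
  obtain ⟨i, hi⟩ : ∃ i, i = (P a + 1) / ω' := ⟨_, rfl⟩
  have hi_le : i * ω' ≤ P a + 1 := hi ▸ Nat.div_mul_le_self _ _
  have hi_lt : P a + 1 < (i + 1) * ω' := by
    rw [hi, mul_comm]
    exact Nat.lt_mul_div_succ _ hω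
  have htop : (i + k + 1) * ω' + lhat ≤ P (b + 1) := by linarith
  have hv_ge : i + k + 1 ≤ v := by
    have : (i + k + 1) * ω' < (v + 1) * ω' := by omega
    exact Nat.lt_succ_iff.1 (lt_of_mul_lt_mul_right this (Nat.zero_le _))
  have hlow : ∀ j ∈ Finset.Icc (i + 1) (i + k + 1), P a + 1 < j * ω' := fun j hj ↦
    hi_lt.trans_le (Nat.mul_le_mul_right _ (Finset.mem_Icc.1 hj).1)
  have hPb_ge : ∀ j ∈ Finset.Icc (i + 1) (i + k + 1), j * ω' - 1 ≤ P b := fun j hj ↦ by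
    have := Nat.mul_le_mul_right ω' (Finset.mem_Icc.1 hj).2
    omega
  have hq_le : ∀ j ∈ Finset.Icc (i + 1) (i + k + 1), q j ≤ b := fun j hj ↦ by
    rw [hq]
    exact Nat.sInf_le (hPb_ge j hj)
  have hq_spec : ∀ j ∈ Finset.Icc (i + 1) (i + k + 1), j * ω' - 1 ≤ P (q j) := fun j hj ↦ by
    rw [hq]
    exact Nat.sInf_mem (s := {t | j * ω' - 1 ≤ P t}) ⟨b, hPb_ge j hj⟩
  have hq_gt : ∀ j ∈ Finset.Icc (i + 1) (i + k + 1), a < q j := fun j hj ↦ by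
    by_contra! h
    have := hmono h
    have := hq_spec j hj
    have := hlow j hj
    omega
  have hq_upper : ∀ j ∈ Finset.Icc (i + 1) (i + k + 1), P (q j) + 1 < (j + 1) * ω' := by
    intro j hj
    obtain ⟨t, ht⟩ : ∃ t, q j = t + 1 := Nat.exists_eq_add_one_of_ne_zero
      (Nat.ne_zero_of_lt (hq_gt j hj))
    have hlt : t < sInf {t | j * ω' - 1 ≤ P t} := by
      rw [← hq, ht]
      exact Nat.lt_succ_self t
    have hPt : ¬ j * ω' - 1 ≤ P t := Nat.notMem_of_lt_sInf (s := {t | j * ω' - 1 ≤ P t}) hlt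
    have hle := hq_le j hj
    have hlen : ℓ t ≤ lhat := hmem (by omega)
    rw [ht, hsucc, add_mul, one_mul]
    omega
  have hinj : Set.InjOn q (Finset.Icc (i + 1) (i + k + 1)) := by
    apply StrictMonoOn.injOn
    intro j hj j' hj' hjj
    by_contra! h
    have := hmono h
    have := hq_spec j' hj'
    have := hq_upper j hj
    have : (j + 1) * ω' ≤ j' * ω' := Nat.mul_le_mul_right ω' hjj
    omega
  have hsubset : (Finset.Icc (i + 1) (i + k + 1)).image q ⊆
      Finset.Icc a b ∩ (Finset.Icc 1 v).image q := by
    refine Finset.subset_inter (Finset.image_subset_iff.2 fun j hj ↦ ?_)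
      (Finset.image_subset_image (Finset.Icc_subset_Icc (Nat.succ_pos i) hv_ge))
    exact Finset.mem_Icc.2 ⟨(hq_gt j hj).le, hq_le j hj⟩
  have hcard := Finset.card_le_card hsubset
  rw [Finset.card_image_of_injOn hinj, hk, Nat.card_Icc] at hcard
  omega
end

section
/- Let p ≥ 1 and v ≥ 1, and for i = 1,…,p let S_i be a sorted array of strings, all n strings across all arrays pairwise distinct, such that every array has the same total character length N/p with (v+1) dividing N/p; set ω' = (N/p)/(v+1) and let ℓ̂ be the maximal length of any string, with ℓ̂ ≤ ω'. On each S_i choose the v character-based samples (for j = 1,…,v, the first string of S_i starting at or after character rank jω'−1 in the concatenation of S_i). Let V be the sorted array of all p·v samples, define splitters f_j = V[vj−1] for j = 1,…,p−1 with sentinels f_0 = −∞ and f_p = +∞, and for j = 1,…,p let bucket b_j be the set of all strings s among the inputs with f_{j−1} < s ≤ f_j. Then the total character length of the strings in every bucket b_j is at most N/p + N/v + (p+v)·ℓ̂. -/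
/-- An order-convex set `B` of string indices containing `k` of the `v` character-based samples
has total character length at most `(k + 1) * w + l`. -/
theorem sum_length_le_of_convex {len : ℕ → ℕ} {m v w l : ℕ}
    (hw : 0 < w) (hl : 0 < l) (hlen : ∀ t < m, len t ≤ l)
    (hsum : ∑ t ∈ Finset.range m, len t = (v + 1) * w)
    (q : ℕ → ℕ) (hq : ∀ a, q a = sInf {t | a * w - 1 ≤ ∑ u ∈ Finset.range t, len u})
    (B : Finset ℕ) (hBm : ∀ t ∈ B, t < m)
    (hconv : ∀ s ∈ B, ∀ u ∈ B, ∀ t, s ≤ t → t ≤ u → t ∈ B) :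
    ∑ t ∈ B, len t ≤ (((Finset.Icc 1 v).filter fun a => q a ∈ B).card + 1) * w + l := by
  rcases B.eq_empty_or_nonempty with rfl | hB
  · simp
  obtain ⟨x, hx⟩ : ∃ x, x = B.min' hB := ⟨_, rfl⟩
  obtain ⟨y, hy⟩ : ∃ y, y = B.max' hB := ⟨_, rfl⟩
  have hxB : x ∈ B := hx ▸ B.min'_mem hB
  have hyB : y ∈ B := hy ▸ B.max'_mem hB
  have hxy : x ≤ y := hx ▸ B.min'_le _ hyB
  have hym := hBm y hyB
  set P : ℕ → ℕ := fun t => ∑ u ∈ Finset.range t, len u with hP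
  have hPmono : Monotone P := fun s t hst =>
    Finset.sum_le_sum_of_subset (Finset.range_mono hst)
  have hPy : P (y + 1) ≤ P y + l := by
    have := hlen y hym
    simp only [hP, Finset.sum_range_succ]
    omega
  have hPm : P (y + 1) ≤ (v + 1) * w := hsum ▸ hPmono hym
  have hBsum : ∑ t ∈ B, len t + P x ≤ P (y + 1) := by
    have h1 : ∑ t ∈ B, len t ≤ ∑ t ∈ Finset.Ico x (y + 1), len t := by
      refine Finset.sum_le_sum_of_subset fun t ht => ?_
      rw [Finset.mem_Ico]
      exact ⟨hx ▸ B.min'_le t ht, Nat.lt_succ_of_le (hy ▸ B.le_max' t ht)⟩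
    have h2 := Finset.sum_range_add_sum_Ico len (show x ≤ y + 1 by omega)
    simp only [hP]
    omega
  obtain ⟨c, hcP, hcx⟩ : ∃ c, c * w ≤ P x + 1 ∧
      ∀ a, c < a → ∀ t, a * w - 1 ≤ P t → x ≤ t := by
    rcases Nat.eq_zero_or_pos x with h0 | h0
    · exact ⟨0, by simp, fun a _ t _ => by omega⟩
    · refine ⟨(P (x - 1) + 1) / w, ?_, fun a ha t ht => ?_⟩
      · have h1 := Nat.div_mul_le_self (P (x - 1) + 1) w
        have h2 : P (x - 1) ≤ P x := hPmono (by omega)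
        omega
      · by_contra! hlt
        have h1 : P t ≤ P (x - 1) := hPmono (by omega)
        have h2 := (Nat.div_lt_iff_lt_mul hw).1 ha
        omega
  obtain ⟨d, hdv, hdP, hdy⟩ : ∃ d, d ≤ v ∧ P (y + 1) + 1 ≤ (d + 1) * w + l ∧
      d * w ≤ P y + 1 := by
    rcases le_total v ((P y + 1) / w) with h | h
    · exact ⟨v, le_rfl, by omega, (Nat.le_div_iff_mul_le hw).1 h⟩
    · have h1 := Nat.lt_div_mul_add (a := P y + 1) hw
      refine ⟨_, h, ?_, Nat.div_mul_le_self _ _⟩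
      rw [add_mul]
      omega
  have hcard : d ≤ ((Finset.Icc 1 v).filter fun a => q a ∈ B).card + c := by
    have hsub : Finset.Icc (c + 1) d ⊆ (Finset.Icc 1 v).filter fun a => q a ∈ B := by
      intro a ha
      rw [Finset.mem_Icc] at ha
      have haw : a * w ≤ d * w := Nat.mul_le_mul_right w ha.2
      have hmem : y ∈ {t | a * w - 1 ≤ P t} := by
        change a * w - 1 ≤ P y
        omega
      refine Finset.mem_filter.2 ⟨Finset.mem_Icc.2 ⟨by omega, by omega⟩, ?_⟩
      refine hconv x hxB y hyB _ ?_ ?_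
      · rw [hq]
        exact hcx a (by omega) _ (Nat.sInf_mem (s := {t | a * w - 1 ≤ P t}) ⟨y, hmem⟩)
      · rw [hq]
        exact Nat.sInf_le hmem
    have := Finset.card_le_card hsub
    rw [Nat.card_Icc] at this
    omega
  have h1 := Nat.mul_le_mul_right w hcard
  rw [add_mul] at h1 hdP ⊢
  omega


/-- Theorem `char-splitting`: `p` sorted arrays of strings
`S i` (with `m i` strings each), all strings across all arrays pairwise distinct,
every array of total character length `N/p = C` with `(v+1) ∣ C`;
`ω' = C/(v+1)`, `lhat` is the maximal string length and `lhat ≤ ω'`.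
On each array the `v` character-based samples `S i (q i j)` are chosen
(`q i j = min { t : P i t ≥ j·ω' - 1 }`), `V` is the sorted array of all `p·v`
samples, and `f j = V (v*j - 1)` for `j = 1,…,p-1` are the splitters (with
sentinels `f 0 = -∞`, `f p = +∞`).  Then the total character length of the
strings in every bucket `b j = { s : f (j-1) < s ≤ f j }` is at most
`N/p + N/v + (p+v)·lhat`. -/
theorem char_splitting_bucket_bound
    {α : Type*} [LinearOrder α] (p v N C : ℕ)
    (hp : 1 ≤ p) (hv : 1 ≤ v) (hN : N = p * C)
    (m : ℕ → ℕ) (hm : ∀ i < p, 1 ≤ m i)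
    (S : ℕ → ℕ → List α)
    (hsorted : ∀ i < p, ∀ s t : ℕ, s ≤ t → t < m i → S i s ≤ S i t)
    (hdistinct : ∀ i₁ < p, ∀ t₁ < m i₁, ∀ i₂ < p, ∀ t₂ < m i₂,
        S i₁ t₁ = S i₂ t₂ → i₁ = i₂ ∧ t₁ = t₂)
    (hC : ∀ i < p, ∑ t ∈ Finset.range (m i), (S i t).length = C)
    (hdvd : (v + 1) ∣ C)
    (ω' : ℕ) (hω' : ω' = C / (v + 1))
    (lhat : ℕ)
    (hlhat : lhat = (Finset.range p).sup
        (fun i => (Finset.range (m i)).sup (fun t => (S i t).length)))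
    (hshort : lhat ≤ ω')
    (P : ℕ → ℕ → ℕ) (hP : ∀ i t, P i t = ∑ u ∈ Finset.range t, (S i u).length)
    (q : ℕ → ℕ → ℕ) (hq : ∀ i j, q i j = sInf {t | j * ω' - 1 ≤ P i t})
    (V : ℕ → List α)
    (hVsorted : ∀ s t : ℕ, s ≤ t → t < p * v → V s ≤ V t)
    (hVinj : ∀ s < p * v, ∀ t < p * v, V s = V t → s = t)
    (hVimage : (Finset.range (p * v)).image V
        = ((Finset.range p) ×ˢ (Finset.Icc 1 v)).image
            (fun x => S x.1 (q x.1 x.2)))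
    (f : ℕ → List α)
    (hf : ∀ j, 1 ≤ j → j ≤ p - 1 → f j = V (v * j - 1))
    (j : ℕ) (hj1 : 1 ≤ j) (hjp : j ≤ p) :
    ∑ i ∈ Finset.range p,
      ∑ t ∈ (Finset.range (m i)).filter
          (fun t => (j = 1 ∨ f (j - 1) < S i t) ∧ (j = p ∨ S i t ≤ f j)),
        (S i t).length
      ≤ N / p + N / v + (p + v) * lhat := by
  have hlen : ∀ i < p, ∀ t < m i, (S i t).length ≤ lhat := fun i hi t ht => by
    rw [hlhat]
    exact (Finset.le_sup (f := fun t => (S i t).length) (Finset.mem_range.2 ht)).trans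
      (Finset.le_sup (f := fun i => (Finset.range (m i)).sup fun t => (S i t).length)
        (Finset.mem_range.2 hi))
  have hCw : C = (v + 1) * ω' := by rw [hω', Nat.mul_div_cancel' hdvd]
  rcases Nat.eq_zero_or_pos lhat with hl | hl
  · refine (Finset.sum_eq_zero fun i hi => Finset.sum_eq_zero fun t ht => ?_).trans_le
      (Nat.zero_le _)
    have := hlen i (Finset.mem_range.1 hi) t (Finset.mem_range.1 (Finset.mem_filter.1 ht).1)
    omega
  have hw : 0 < ω' := by omega
  set B : ℕ → Finset ℕ := fun i => (Finset.range (m i)).filter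
    (fun t => (j = 1 ∨ f (j - 1) < S i t) ∧ (j = p ∨ S i t ≤ f j)) with hB
  have hbound : ∀ i ∈ Finset.range p, ∑ t ∈ B i, (S i t).length ≤
      (((Finset.Icc 1 v).filter fun a => q i a ∈ B i).card + 1) * ω' + lhat := by
    intro i hi
    rw [Finset.mem_range] at hi
    refine sum_length_le_of_convex hw hl (hlen i hi) ((hC i hi).trans hCw) (q i)
      (fun a => by simp only [hq, hP]) (B i)
      (fun t ht => Finset.mem_range.1 (Finset.mem_filter.1 ht).1) ?_
    intro s hs u hu t hst htu
    simp only [hB, Finset.mem_filter, Finset.mem_range] at hs hu ⊢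
    have htm : t < m i := htu.trans_lt hu.1
    exact ⟨htm, hs.2.1.imp_right fun h => h.trans_le (hsorted i hi s t hst htm),
      hu.2.2.imp_right fun h => (hsorted i hi t u htu hu.1).trans h⟩
  have hinj : Set.InjOn (fun x : ℕ × ℕ => S x.1 (q x.1 x.2))
      (Finset.range p ×ˢ Finset.Icc 1 v : Finset (ℕ × ℕ)) := by
    rw [← Finset.card_image_iff, ← hVimage, Finset.card_image_of_injOn]
    · simp
    · intro s hs t ht h
      exact hVinj s (by simpa using hs) t (by simpa using ht) h
  have hcount : ∑ i ∈ Finset.range p, ((Finset.Icc 1 v).filter fun a => q i a ∈ B i).card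
      ≤ v := by
    have hprod : ∑ i ∈ Finset.range p, ((Finset.Icc 1 v).filter fun a => q i a ∈ B i).card
        = ((Finset.range p ×ˢ Finset.Icc 1 v).filter fun x => q x.1 x.2 ∈ B x.1).card := by
      simp only [Finset.card_filter, Finset.sum_product]
    have hsub : ((Finset.range p ×ˢ Finset.Icc 1 v).filter fun x => q x.1 x.2 ∈ B x.1).image
        (fun x => S x.1 (q x.1 x.2)) ⊆ (Finset.Ico (v * (j - 1)) (v * j)).image V := by
      intro s hs
      obtain ⟨x, hx, rfl⟩ := Finset.mem_image.1 hs
      obtain ⟨hx1, hx2⟩ := Finset.mem_filter.1 hx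
      have hV := Finset.mem_image_of_mem (fun x : ℕ × ℕ => S x.1 (q x.1 x.2)) hx1
      rw [← hVimage] at hV
      obtain ⟨k, hk, hVk⟩ := Finset.mem_image.1 hV
      rw [Finset.mem_range] at hk
      obtain ⟨-, hlo, hhi⟩ := Finset.mem_filter.1 hx2
      refine Finset.mem_image.2 ⟨k, Finset.mem_Ico.2 ⟨?_, ?_⟩, hVk⟩
      · rcases hlo with rfl | hlo
        · simp
        · by_contra! hlt
          have hj2 : j ≠ 1 := by
            rintro rfl
            simp at hlt
          rw [hf (j - 1) (by omega) (by omega), ← hVk] at hlo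
          have hle : v * (j - 1) ≤ p * v := by
            rw [mul_comm p]
            exact Nat.mul_le_mul_left v (by omega)
          exact (hVsorted k (v * (j - 1) - 1) (by omega) (by omega)).not_gt hlo
      · rcases hhi with rfl | hhi
        · rwa [mul_comm]
        · by_contra! hle
          have hjp' : j ≠ p := by
            rintro rfl
            rw [mul_comm] at hle
            omega
          have hpos : 0 < v * j := Nat.mul_pos hv hj1
          rw [hf j hj1 (by omega), ← hVk] at hhi
          have := hVinj k hk (v * j - 1) (by omega)
            (hhi.antisymm (hVsorted (v * j - 1) k (by omega) hk))
          omega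
    have hcard := (Finset.card_le_card hsub).trans Finset.card_image_le
    rw [Finset.card_image_of_injOn (hinj.mono (Finset.coe_subset.2 (Finset.filter_subset _ _))),
      Nat.card_Ico, ← Nat.mul_sub, show j - (j - 1) = 1 by omega, mul_one] at hcard
    exact hprod.trans_le hcard
  have htotal := Finset.sum_le_sum hbound
  rw [Finset.sum_add_distrib, ← Finset.sum_mul, Finset.sum_add_distrib] at htotal
  simp only [Finset.sum_const, Finset.card_range, smul_eq_mul, mul_one] at htotal
  have hNp : N / p = (v + 1) * ω' := by rw [hN, Nat.mul_div_cancel_left _ hp, hCw]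
  have hNv : p * ω' ≤ N / v := by
    rw [Nat.le_div_iff_mul_le hv, hN, hCw]
    nlinarith [Nat.zero_le (p * ω')]
  rw [hNp]
  refine htotal.trans ?_
  nlinarith [Nat.mul_le_mul_right ω' hcount, Nat.zero_le (v * lhat)]
end
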